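/- Let n ≥ 3. Then H(Res(f₀+f₁x+f₂x², g₀+g₁x+⋯+gₙxⁿ)) = H(Res(f₀+f₁x+f₂x², g₀+gₙxⁿ)); that is, the height of the resultant of a generic quadratic with a generic degree-n polynomial equals the height of the resultant of a generic quadratic with the generic binomial g₀ + gₙxⁿ. -/

import Mathlib

noncomputable section

open MvPolynomial

/-- The generic Sylvester matrix of a degree-`m` polynomial `f = f₀ + ⋯ + f_m xᵐ` and a
degree-`n` polynomial `g = g₀ + ⋯ + gₙ xⁿ`: its first `n` columns contain the shifted
coefficients of `f` (the indeterminates `Sum.inl i`) and its last `m` columns contain the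
shifted coefficients of `g` (the indeterminates `Sum.inr j`). -/
def sylvesterMatrix (m n : ℕ) :
    Matrix (Fin (m + n)) (Fin (m + n)) (MvPolynomial (Fin (m + 1) ⊕ Fin (n + 1)) ℤ) :=
  Matrix.of fun i j =>
    if (j : ℕ) < n then
      if h : (j : ℕ) ≤ (i : ℕ) ∧ (i : ℕ) - (j : ℕ) ≤ m then
        X (Sum.inl ⟨(i : ℕ) - (j : ℕ), Nat.lt_succ_of_le h.2⟩)
      else 0
    else
      if h : (j : ℕ) - n ≤ (i : ℕ) ∧ (i : ℕ) - ((j : ℕ) - n) ≤ n then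
        X (Sum.inr ⟨(i : ℕ) - ((j : ℕ) - n), Nat.lt_succ_of_le h.2⟩)
      else 0

/-- `genRes m n` is the Sylvester resultant `Res(f,g)` of the generic polynomials
`f` of degree `m` and `g` of degree `n`. -/
def genRes (m n : ℕ) : MvPolynomial (Fin (m + 1) ⊕ Fin (n + 1)) ℤ :=
  (sylvesterMatrix m n).det

/-- The height of an integer multivariate polynomial:
the maximum of the absolute values of its coefficients. -/
def height {σ : Type*} (P : MvPolynomial σ ℤ) : ℕ :=
  P.support.sup fun s => (P.coeff s).natAbs

/-- The algebra map specializing the generic degree-`n` polynomial `g` to the generic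
binomial `g₀ + gₙ xⁿ`, i.e. setting `g₁ = ⋯ = g_{n-1} = 0`. -/
def toBinomial (m n : ℕ) :
    MvPolynomial (Fin (m + 1) ⊕ Fin (n + 1)) ℤ →ₐ[ℤ] MvPolynomial (Fin (m + 1) ⊕ Fin (n + 1)) ℤ :=
  aeval fun s => match s with
    | Sum.inl i => X (Sum.inl i)
    | Sum.inr j => if (j : ℕ) = 0 ∨ (j : ℕ) = n then X (Sum.inr j) else 0

/-- `lucasCoeff k l` is the absolute value of the coefficient of
`(x + y) ^ (k - 2 * l) * (x * y) ^ l`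
in the power sum `x ^ k + y ^ k`. -/
def lucasCoeff : ℕ → ℕ → ℕ
  | 0, 0 => 2
  | 0, _ + 1 => 0
  | 1, 0 => 1
  | 1, _ + 1 => 0
  | k + 2, 0 => lucasCoeff (k + 1) 0
  | k + 2, l + 1 => lucasCoeff (k + 1) (l + 1) + lucasCoeff k l

lemma lucasCoeff_eq_zero : ∀ {k l : ℕ}, k < 2 * l → lucasCoeff k l = 0
  | 0, 0, h => by omega
  | 0, _ + 1, _ => by simp [lucasCoeff]
  | 1, 0, h => by omega
  | 1, _ + 1, _ => by simp [lucasCoeff]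
  | k + 2, 0, h => by omega
  | k + 2, l + 1, h => by
    rw [lucasCoeff, lucasCoeff_eq_zero (by omega), lucasCoeff_eq_zero (by omega)]

lemma lucasCoeff_succ_le (k l : ℕ) : lucasCoeff (k + 1) l ≤ lucasCoeff (k + 2) l := by
  cases l <;> simp [lucasCoeff]

lemma lucasCoeff_le {k n : ℕ} (hk : 0 < k) (hkn : k ≤ n) (l : ℕ) :
    lucasCoeff k l ≤ lucasCoeff n l := by
  induction n, hkn using Nat.le_induction with
  | base => rfl
  | succ n hn ih =>
    obtain ⟨m, rfl⟩ : ∃ m, n = m + 1 := ⟨n - 1, by omega⟩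
    exact ih.trans (lucasCoeff_succ_le m l)

lemma pow_add_pow_eq_sum {R : Type*} [CommRing R] (x y : R) : ∀ (k N : ℕ), k < 2 * N →
    x ^ k + y ^ k = ∑ l ∈ Finset.range N,
      (-1) ^ l * (lucasCoeff k l : R) * (x + y) ^ (k - 2 * l) * (x * y) ^ l
  | 0, 0, h => by omega
  | 0, N + 1, _ => by
    rw [Finset.sum_range_succ']
    norm_num [lucasCoeff]
  | 1, 0, h => by omega
  | 1, N + 1, _ => by
    rw [Finset.sum_range_succ']
    norm_num [lucasCoeff]
  | k + 2, 0, h => by omega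
  | k + 2, N + 1, h => by
    have h₁ := pow_add_pow_eq_sum x y (k + 1) (N + 1) (by omega)
    have h₀ := pow_add_pow_eq_sum x y k N (by omega)
    have key : x ^ (k + 2) + y ^ (k + 2) =
        (x + y) * (x ^ (k + 1) + y ^ (k + 1)) - x * y * (x ^ k + y ^ k) := by ring
    rw [key, h₁, h₀, Finset.sum_range_succ', Finset.sum_range_succ', mul_add, Finset.mul_sum,
      Finset.mul_sum, add_sub_right_comm, ← Finset.sum_sub_distrib]
    congr 1
    · refine Finset.sum_congr rfl fun l _ => ?_
      rw [lucasCoeff, show k + 2 - 2 * (l + 1) = k - 2 * l by omega]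
      rcases lt_or_ge (k + 1) (2 * (l + 1)) with hl | hl
      · rw [lucasCoeff_eq_zero hl]
        push_cast
        ring
      · rw [show k - 2 * l = k + 1 - 2 * (l + 1) + 1 by omega]
        push_cast
        ring
    · simp only [lucasCoeff]
      simp
      ring

lemma sum_sum_eq_sum_sum_ite {ι R : Type*} [Fintype ι] [LinearOrder ι] [CommRing R]
    (h : ι → ι → R) :
    ∑ i, ∑ j, h i j =
      ∑ i, ∑ j, if i = j then h i i else if i < j then h i j + h j i else 0 := by
  have split : ∀ i j, h i j = (if i = j then h i i else if i < j then h i j else 0) +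
      if j < i then h i j else 0 := by
    intro i j
    rcases lt_trichotomy i j with hij | rfl | hij
    · simp [hij, hij.ne, hij.not_gt]
    · simp
    · simp [hij, hij.ne', hij.not_gt]
  calc ∑ i, ∑ j, h i j
      = ∑ i, ∑ j, (if i = j then h i i else if i < j then h i j else 0) +
          ∑ i, ∑ j, if j < i then h i j else 0 := by
        simp_rw [← Finset.sum_add_distrib, ← split]
    _ = ∑ i, ∑ j, (if i = j then h i i else if i < j then h i j else 0) +
          ∑ i, ∑ j, if i < j then h j i else 0 := by
        rw [Finset.sum_comm (f := fun i j => if j < i then h i j else 0)]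
    _ = _ := by
        simp_rw [← Finset.sum_add_distrib]
        refine Finset.sum_congr rfl fun i _ => Finset.sum_congr rfl fun j _ => ?_
        rcases lt_trichotomy i j with hij | rfl | hij
        · simp [hij, hij.ne]
        · simp
        · simp [hij.ne', hij.not_gt]

lemma height_sum_monomial {ι σ : Type*} (T : Finset ι) (E : ι → σ →₀ ℕ) (c : ι → ℤ)
    (hE : ∀ s ∈ T, ∀ t ∈ T, c s ≠ 0 → c t ≠ 0 → E s = E t → s = t) :
    height (∑ t ∈ T, monomial (E t) (c t)) = T.sup fun t => (c t).natAbs := by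
  classical
  have coeff_E : ∀ t ∈ T, c t ≠ 0 → (∑ t ∈ T, monomial (E t) (c t)).coeff (E t) = c t := by
    intro t ht hct
    rw [coeff_sum, Finset.sum_eq_single_of_mem t ht]
    · simp
    · intro s hs hst
      rw [coeff_monomial, ite_eq_right_iff]
      intro h
      by_contra hcs
      exact hst (hE s hs t ht hcs hct h)
  apply le_antisymm
  · refine Finset.sup_le fun s hs => ?_
    rw [mem_support_iff] at hs
    obtain ⟨t, ht, hts⟩ : ∃ t ∈ T, coeff s (monomial (E t) (c t)) ≠ 0 := by
      rw [coeff_sum] at hs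
      exact Finset.exists_ne_zero_of_sum_ne_zero hs
    rw [coeff_monomial] at hts
    obtain ⟨rfl, hct⟩ : E t = s ∧ c t ≠ 0 := by simpa using hts
    rw [coeff_E t ht hct]
    exact Finset.le_sup (f := fun t => (c t).natAbs) ht
  · refine Finset.sup_le fun t ht => ?_
    rcases eq_or_ne (c t) 0 with hct | hct
    · simp [hct]
    · rw [← coeff_E t ht hct]
      refine Finset.le_sup (f := fun s => (coeff s (∑ t ∈ T, monomial (E t) (c t))).natAbs) ?_
      rwa [mem_support_iff, coeff_E t ht hct]

/-- The generic polynomial of degree `n` with coefficients `u 0, …, u n`. -/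
def polyOfCoeffs {R : Type*} [Semiring R] {n : ℕ} (u : Fin (n + 1) → R) : Polynomial R :=
  ∑ i : Fin (n + 1), Polynomial.monomial (i : ℕ) (u i)

lemma coeff_polyOfCoeffs {R : Type*} [Semiring R] {n : ℕ} (u : Fin (n + 1) → R) (k : ℕ) :
    (polyOfCoeffs u).coeff k = if h : k < n + 1 then u ⟨k, h⟩ else 0 := by
  rw [polyOfCoeffs, Polynomial.finsetSum_coeff]
  simp only [Polynomial.coeff_monomial]
  split_ifs with h
  · rw [Finset.sum_eq_single ⟨k, h⟩] <;> simp +contextual [Fin.ext_iff]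
  · refine Finset.sum_eq_zero fun i _ => if_neg ?_
    have := i.2
    omega

lemma natDegree_polyOfCoeffs_le {R : Type*} [Semiring R] {n : ℕ} (u : Fin (n + 1) → R) :
    (polyOfCoeffs u).natDegree ≤ n := by
  rw [Polynomial.natDegree_le_iff_coeff_eq_zero]
  intro k hk
  rw [coeff_polyOfCoeffs, dif_neg (by omega)]

lemma map_polyOfCoeffs {R S : Type*} [Semiring R] [Semiring S] {n : ℕ} (φ : R →+* S)
    (u : Fin (n + 1) → R) : (polyOfCoeffs u).map φ = polyOfCoeffs fun i => φ (u i) := by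
  simp [polyOfCoeffs, Polynomial.map_sum]

lemma genRes_eq_resultant (m n : ℕ) :
    genRes m n = Polynomial.resultant
      (polyOfCoeffs fun j => X (Sum.inr j)) (polyOfCoeffs fun i => X (Sum.inl i)) n m := by
  rw [Polynomial.resultant, genRes, ← Matrix.det_reindex_self (finCongr (Nat.add_comm m n))]
  congr 1
  ext1 i j
  rw [Matrix.reindex_apply, Matrix.submatrix_apply]
  induction j using Fin.addCases with
  | left j =>
    have := j.2
    simp only [sylvesterMatrix, Polynomial.sylvester, Matrix.of_apply, Fin.addCases_left,
      coeff_polyOfCoeffs, finCongr_symm, finCongr_apply, Fin.val_cast, Fin.val_castAdd, this,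
      if_true, Set.mem_Icc]
    split_ifs <;> first | rfl | omega
  | right j =>
    have := j.2
    simp only [sylvesterMatrix, Polynomial.sylvester, Matrix.of_apply, Fin.addCases_right,
      coeff_polyOfCoeffs, finCongr_symm, finCongr_apply, Fin.val_cast, Fin.val_natAdd,
      Set.mem_Icc, Nat.add_sub_cancel_left, if_neg (Nat.not_lt.2 (Nat.le_add_right n j))]
    split_ifs <;> first | rfl | omega

lemma map_genRes_two {S : Type*} [CommRing S] [Nontrivial S] (n : ℕ)
    (φ : MvPolynomial (Fin (2 + 1) ⊕ Fin (n + 1)) ℤ →+* S) (a b : S)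
    (h₀ : φ (X (Sum.inl 0)) = φ (X (Sum.inl 2)) * (a * b))
    (h₁ : φ (X (Sum.inl 1)) = -(φ (X (Sum.inl 2)) * (a + b))) :
    φ (genRes 2 n) = φ (X (Sum.inl 2)) ^ n *
      ((∑ i : Fin (n + 1), φ (X (Sum.inr i)) * a ^ (i : ℕ)) *
        ∑ j : Fin (n + 1), φ (X (Sum.inr j)) * b ^ (j : ℕ)) := by
  have hf : polyOfCoeffs (fun i => φ (X (Sum.inl i))) = Polynomial.C (φ (X (Sum.inl 2))) *
      ((Polynomial.X - Polynomial.C a) * (Polynomial.X - Polynomial.C b)) := by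
    rw [polyOfCoeffs, Fin.sum_univ_three, h₀, h₁]
    simp only [← Polynomial.C_mul_X_pow_eq_monomial]
    simp
    ring
  rw [genRes_eq_resultant, ← Polynomial.resultant_map_map, map_polyOfCoeffs, map_polyOfCoeffs, hf,
    Polynomial.resultant_comm, Polynomial.resultant_C_mul_left]
  have := Polynomial.resultant_mul_left (Polynomial.X - Polynomial.C a)
    (Polynomial.X - Polynomial.C b) (polyOfCoeffs fun j => φ (X (Sum.inr j))) n
    (natDegree_polyOfCoeffs_le _)
  rw [Polynomial.natDegree_X_sub_C, Polynomial.natDegree_X_sub_C,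
    Polynomial.resultant_X_sub_C_left _ _ _ (natDegree_polyOfCoeffs_le _),
    Polynomial.resultant_X_sub_C_left _ _ _ (natDegree_polyOfCoeffs_le _)] at this
  rw [this, Even.neg_one_pow ⟨n, by ring⟩]
  simp [polyOfCoeffs, Polynomial.eval_finsetSum]

/-- The coefficient in `genRes 2 n` of the monomial `quadExponent n i j l`. -/
def quadCoeff (i j l : ℕ) : ℤ :=
  if i = j then (if l = 0 then 1 else 0)
  else if i < j then (-1) ^ (j - i + l) * lucasCoeff (j - i) l else 0

/-- The exponent of `gᵢ gⱼ f₀ ^ (i + l) f₁ ^ (j - i - 2l) f₂ ^ (n - j + l)`. -/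
def quadExponent (n : ℕ) (i j : Fin (n + 1)) (l : ℕ) : Fin (2 + 1) ⊕ Fin (n + 1) →₀ ℕ :=
  Finsupp.single (Sum.inr i) 1 + Finsupp.single (Sum.inr j) 1 +
    Finsupp.single (Sum.inl 0) (i + l) + Finsupp.single (Sum.inl 1) (j - i - 2 * l) +
    Finsupp.single (Sum.inl 2) (n - j + l)

lemma monomial_quadExponent (n : ℕ) (i j : Fin (n + 1)) (l : ℕ) (c : ℤ) :
    monomial (quadExponent n i j l) c = C c * (X (Sum.inr i) * X (Sum.inr j) *
      X (Sum.inl 0) ^ (i + l : ℕ) * X (Sum.inl 1) ^ (j - i - 2 * l : ℕ) *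
      X (Sum.inl 2) ^ (n - j + l : ℕ)) := by
  have hX : ∀ k : Fin (n + 1), (X (Sum.inr k) : MvPolynomial (Fin (2 + 1) ⊕ Fin (n + 1)) ℤ) =
      monomial (Finsupp.single (Sum.inr k) 1) 1 := fun _ => rfl
  simp only [hX, X_pow_eq_monomial, monomial_mul, C_mul_monomial, mul_one, quadExponent]

lemma le_and_two_mul_le_of_quadCoeff_ne_zero {i j l : ℕ} (h : quadCoeff i j l ≠ 0) :
    i ≤ j ∧ 2 * l ≤ j - i := by
  unfold quadCoeff at h
  split_ifs at h with h₁ h₂ h₃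
  · omega
  · simp at h
  · refine ⟨h₃.le, ?_⟩
    by_contra hl
    rw [lucasCoeff_eq_zero (by omega)] at h
    simp at h
  · simp at h

lemma quadExponent_injective {n : ℕ} {i j i' j' : Fin (n + 1)} {l l' : ℕ} (hij : i ≤ j)
    (hij' : i' ≤ j') (h : quadExponent n i j l = quadExponent n i' j' l') :
    i = i' ∧ j = j' ∧ l = l' := by
  have hg : ∀ k : Fin (n + 1), ((if i = k then 1 else 0) + if j = k then 1 else 0 : ℕ) =
      (if i' = k then 1 else 0) + if j' = k then 1 else 0 := by
    intro k
    simpa [quadExponent, Finsupp.single_apply] using DFunLike.congr_fun h (Sum.inr k)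
  have hf : (i + l : ℕ) = i' + l' := by
    simpa [quadExponent, Finsupp.single_apply] using DFunLike.congr_fun h (Sum.inl 0)
  have h₁ := hg i
  have h₂ := hg j
  have h₃ := hg i'
  have h₄ := hg j'
  have hi : i = i' := by grind
  have hj : j = j' := by grind
  subst hi hj
  exact ⟨rfl, rfl, by omega⟩

lemma quadratic_expansion_term {R : Type*} [CommRing R] {n i j : ℕ} (hj : j ≤ n)
    (c a b u v : R) (huv : i = j → u = v) :
    (if i = j then c ^ n * (u * a ^ i * (u * b ^ i)) else if i < j then
      c ^ n * (u * a ^ i * (v * b ^ j)) + c ^ n * (v * a ^ j * (u * b ^ i)) else 0) =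
    ∑ l ∈ Finset.range (n + 1), (quadCoeff i j l : R) * (u * v * (c * (a * b)) ^ (i + l) *
      (-(c * (a + b))) ^ (j - i - 2 * l) * c ^ (n - j + l)) := by
  rcases lt_trichotomy i j with hij | rfl | hij
  · obtain ⟨k, rfl⟩ := Nat.exists_eq_add_of_lt hij
    have expand : c ^ n * (u * a ^ i * (v * b ^ (i + k + 1))) +
        c ^ n * (v * a ^ (i + k + 1) * (u * b ^ i)) =
        c ^ n * u * v * (a * b) ^ i * (a ^ (k + 1) + b ^ (k + 1)) := by ring
    rw [if_neg hij.ne, if_pos hij, expand, pow_add_pow_eq_sum a b (k + 1) (n + 1) (by omega),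
      Finset.mul_sum]
    refine Finset.sum_congr rfl fun l _ => ?_
    rw [quadCoeff, if_neg hij.ne, if_pos hij, show i + k + 1 - i = k + 1 by omega]
    rcases lt_or_ge (k + 1) (2 * l) with hl | hl
    · simp [lucasCoeff_eq_zero hl]
    · obtain ⟨m, hm⟩ := Nat.exists_eq_add_of_le hl
      obtain ⟨r, rfl⟩ := Nat.exists_eq_add_of_le hj
      rw [show i + k + 1 + r - (i + k + 1) = r by omega, show i + k + 1 = i + (k + 1) by ring, hm,
        Nat.add_sub_cancel_left, neg_pow (c * (a + b)), mul_pow c (a + b)]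
      have sign : ((-1) ^ (2 * l + m + l) * (-1) ^ m : R) = (-1) ^ l := by
        rw [← pow_add, show 2 * l + m + l + m = 2 * (l + m) + l by ring, pow_add]
        simp
      push_cast
      rw [← sign]
      ring
  · obtain rfl := huv rfl
    rw [if_pos rfl, Finset.sum_eq_single_of_mem 0 (by simp)]
    · obtain ⟨r, rfl⟩ := Nat.exists_eq_add_of_le hj
      simp [quadCoeff]
      ring
    · intro l _ hl
      simp [quadCoeff, hl]
  · simp [quadCoeff, hij.ne', hij.not_gt]

lemma exists_injective_ringHom_vieta.{u} {A : Type u} [CommRing A] [IsDomain A] (p q : A) {r : A}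
    (hr : r ≠ 0) : ∃ (K : Type u) (_ : Field K) (φ : A →+* K) (a b : K), Function.Injective φ ∧
      φ p = φ r * (a * b) ∧ φ q = -(φ r * (a + b)) := by
  let φ : A →+* AlgebraicClosure (FractionRing A) :=
    (algebraMap (FractionRing A) _).comp (algebraMap A (FractionRing A))
  have hφ : Function.Injective φ :=
    (algebraMap (FractionRing A) _).injective.comp (IsFractionRing.injective A _)
  have hc : φ r ≠ 0 := (map_ne_zero_iff φ hφ).2 hr
  obtain ⟨a, ha⟩ := IsAlgClosed.exists_root (Polynomial.C (φ r) * Polynomial.X ^ 2 +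
    Polynomial.C (φ q) * Polynomial.X + Polynomial.C (φ p))
    (by rw [Polynomial.degree_quadratic hc]; decide)
  simp only [Polynomial.IsRoot, Polynomial.eval_add, Polynomial.eval_mul, Polynomial.eval_C,
    Polynomial.eval_pow, Polynomial.eval_X] at ha
  obtain ⟨b, hb⟩ : ∃ b, φ q = -(φ r * (a + b)) :=
    ⟨-φ q / φ r - a, by rw [add_sub_cancel, mul_div_cancel₀ _ hc, neg_neg]⟩
  refine ⟨_, inferInstance, φ, a, b, hφ, ?_, hb⟩
  rw [hb] at ha
  linear_combination ha

lemma genRes_two_eq_sum (n : ℕ) :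
    genRes 2 n = ∑ t : Fin (n + 1) × Fin (n + 1) × Fin (n + 1),
      monomial (quadExponent n t.1 t.2.1 t.2.2) (quadCoeff t.1 t.2.1 t.2.2) := by
  obtain ⟨K, _, φ, a, b, hφ, h₀, hb⟩ := exists_injective_ringHom_vieta
    (A := MvPolynomial (Fin (2 + 1) ⊕ Fin (n + 1)) ℤ)
    (X (Sum.inl 0)) (X (Sum.inl 1)) (X_ne_zero (Sum.inl 2))
  apply hφ
  rw [map_genRes_two n φ a b h₀ hb, map_sum, Finset.sum_mul_sum, Finset.mul_sum]
  simp_rw [Finset.mul_sum]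
  rw [sum_sum_eq_sum_sum_ite, Fintype.sum_prod_type]
  refine Finset.sum_congr rfl fun i _ => ?_
  rw [Fintype.sum_prod_type]
  refine Finset.sum_congr rfl fun j _ => ?_
  have := quadratic_expansion_term (i := i) (Nat.lt_succ_iff.1 j.2) (φ (X (Sum.inl 2))) a b
    (φ (X (Sum.inr i))) (φ (X (Sum.inr j))) fun h => by rw [Fin.ext h]
  simp only [Fin.ext_iff, Fin.lt_def]
  rw [this, Finset.sum_range]
  refine Finset.sum_congr rfl fun l _ => ?_
  rw [monomial_quadExponent, ← h₀, ← hb]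
  simp

lemma toBinomial_monomial_quadExponent (n : ℕ) (i j : Fin (n + 1)) (l : ℕ) (c : ℤ) :
    toBinomial 2 n (monomial (quadExponent n i j l) c) =
      if ((i : ℕ) = 0 ∨ (i : ℕ) = n) ∧ ((j : ℕ) = 0 ∨ (j : ℕ) = n) then
        monomial (quadExponent n i j l) c else 0 := by
  rw [monomial_quadExponent]
  simp only [map_mul, map_pow, toBinomial, aeval_X, algHom_C]
  split_ifs <;> simp_all

lemma natAbs_quadCoeff_of_lt {i j : ℕ} (h : i < j) (l : ℕ) :
    (quadCoeff i j l).natAbs = lucasCoeff (j - i) l := by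
  simp [quadCoeff, h, h.ne, Int.natAbs_mul, Int.natAbs_pow]

/-- For `n ≥ 3`, the height of the resultant of a generic quadratic with a generic degree-`n`
polynomial equals the height of the resultant of a generic quadratic with the generic
binomial `g₀ + gₙxⁿ`. -/
theorem height_quadratic_eq_binomial (n : ℕ) (hn : 3 ≤ n) :
    height (genRes 2 n) = height (toBinomial 2 n (genRes 2 n)) := by
  have inj : ∀ s t : Fin (n + 1) × Fin (n + 1) × Fin (n + 1),
      quadCoeff s.1 s.2.1 s.2.2 ≠ 0 → quadCoeff t.1 t.2.1 t.2.2 ≠ 0 →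
      quadExponent n s.1 s.2.1 s.2.2 = quadExponent n t.1 t.2.1 t.2.2 → s = t := by
    rintro ⟨i, j, l⟩ ⟨i', j', l'⟩ hs ht h
    obtain ⟨rfl, rfl, hl⟩ := quadExponent_injective (le_and_two_mul_le_of_quadCoeff_ne_zero hs).1
      (le_and_two_mul_le_of_quadCoeff_ne_zero ht).1 h
    exact Prod.ext rfl (Prod.ext rfl (Fin.ext hl))
  rw [genRes_two_eq_sum, map_sum]
  simp_rw [toBinomial_monomial_quadExponent]
  rw [← Finset.sum_filter,
    height_sum_monomial _ (fun t : Fin (n + 1) × Fin (n + 1) × Fin (n + 1) =>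
      quadExponent n t.1 t.2.1 t.2.2) _ fun s _ t _ => inj s t,
    height_sum_monomial _ (fun t : Fin (n + 1) × Fin (n + 1) × Fin (n + 1) =>
      quadExponent n t.1 t.2.1 t.2.2) _ fun s _ t _ => inj s t]
  refine le_antisymm (Finset.sup_le ?_) (Finset.sup_mono (Finset.filter_subset _ _))
  rintro ⟨i, j, l⟩ -
  rcases lt_trichotomy (i : ℕ) j with hij | hij | hij
  · have hmem : ((0 : Fin (n + 1)), Fin.last n, l) ∈ Finset.univ.filter
        fun t : Fin (n + 1) × Fin (n + 1) × Fin (n + 1) =>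
          ((t.1 : ℕ) = 0 ∨ (t.1 : ℕ) = n) ∧ ((t.2.1 : ℕ) = 0 ∨ (t.2.1 : ℕ) = n) := by simp
    refine le_trans ?_ (Finset.le_sup hmem)
    simp only [Fin.val_zero, Fin.val_last]
    rw [natAbs_quadCoeff_of_lt hij, natAbs_quadCoeff_of_lt (by omega)]
    exact lucasCoeff_le (by omega) (by omega) _
  · have hmem : ((0 : Fin (n + 1)), (0 : Fin (n + 1)), (0 : Fin (n + 1))) ∈ Finset.univ.filter
        fun t : Fin (n + 1) × Fin (n + 1) × Fin (n + 1) =>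
          ((t.1 : ℕ) = 0 ∨ (t.1 : ℕ) = n) ∧ ((t.2.1 : ℕ) = 0 ∨ (t.2.1 : ℕ) = n) := by simp
    refine le_trans ?_ (Finset.le_sup hmem)
    rw [show (quadCoeff (0 : Fin (n + 1)) (0 : Fin (n + 1)) (0 : Fin (n + 1))).natAbs = 1 by
      simp [quadCoeff]]
    change (quadCoeff i j l).natAbs ≤ 1
    rw [quadCoeff, if_pos hij]
    split_ifs <;> simp
  · simp [quadCoeff, hij.ne', hij.not_gt]
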